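/- arXiv:2408.13558 — 2 statements merged into one kernel-verified Lean document; each statement's English description precedes it below -/
import Mathlib

section
/- Let α ≥ β ≥ 1 be integers and let G be a finite group of order 2^(α+β+1) together with elements a, b, c such that G is generated by {a, b, c}, the commutator [a,b] = a⁻¹b⁻¹ab equals c, c commutes with both a and b, orderOf a = 2^α, orderOf b = 2^β, orderOf c = 2, the cyclic subgroups ⟨a⟩ and ⟨c⟩ intersect trivially, and the subgroups ⟨a, c⟩ and ⟨b⟩ intersect trivially (this is the group G₁ with γ = 1). Then the ordered Davenport constant of G equals its Loewy length: D_o(G) = L(G) = 2^α + 2^β + 1. -/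
/-- A list (ordered sequence) over `G` is product-one free if no nonempty
order-preserving sublist has product equal to the identity. -/
def OrderedProductOneFree {G : Type*} [Group G] (l : List G) : Prop :=
  ∀ t : List G, t.Sublist l → t ≠ [] → t.prod ≠ 1

/-- The ordered Davenport constant: the smallest `k` such that every list of
elements of `G` of length at least `k` has a nonempty sublist with product one. -/
noncomputable def orderedDavenport (G : Type*) [Group G] : ℕ :=
  sInf {k : ℕ | ∀ l : List G, k ≤ l.length → ¬ OrderedProductOneFree l}
/-- The Loewy length of a finite `p`-group `G`: the least positive integer `n` such that
the `n`-th power of the Jacobson radical of the group algebra `𝔽_p[G]` vanishes. -/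
noncomputable def loewyLength (p : ℕ) (G : Type*) [Group G] : ℕ :=
  sInf {n : ℕ | 0 < n ∧ (Ideal.jacobson (⊥ : Ideal (MonoidAlgebra (ZMod p) G))) ^ n = ⊥}

section Filtration

variable (K : Type*) {R : Type*} [CommRing K] [Ring R] [Algebra K R]

/-- The span of the monomials `X ^ i * Y ^ j * Z ^ k` of weight `i + j + 2 * k` at least `w`. -/
def weightFiltration (X Y Z : R) (w : ℕ) : Submodule K R :=
  Submodule.span K {r | ∃ i j k : ℕ, w ≤ i + j + 2 * k ∧ r = X ^ i * (Y ^ j * Z ^ k)}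

variable {X Y Z : R} {w : ℕ} {f : R}

lemma monomial_mem_weightFiltration {i j k : ℕ} (h : w ≤ i + j + 2 * k) :
    X ^ i * (Y ^ j * Z ^ k) ∈ weightFiltration K X Y Z w :=
  Submodule.subset_span ⟨i, j, k, h, rfl⟩

lemma weightFiltration_antitone : Antitone (weightFiltration K X Y Z) := fun _ _ h ↦
  Submodule.span_mono fun _ ⟨i, j, k, hw, hr⟩ ↦ ⟨i, j, k, h.trans hw, hr⟩

lemma mul_mem_weightFiltration_of_monomial {d : ℕ} (r : R)
    (h : ∀ i j k, r * (X ^ i * (Y ^ j * Z ^ k)) ∈ weightFiltration K X Y Z (i + j + 2 * k + d))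
    (hf : f ∈ weightFiltration K X Y Z w) : r * f ∈ weightFiltration K X Y Z (w + d) := by
  induction hf using Submodule.span_induction with
  | mem x hx =>
    obtain ⟨i, j, k, hw, rfl⟩ := hx
    exact weightFiltration_antitone K (by lia) (h i j k)
  | zero => simp
  | add x y _ _ hx hy => rw [mul_add]; exact add_mem hx hy
  | smul t x _ hx => rw [mul_smul_comm]; exact Submodule.smul_mem _ t hx

lemma X_mul_mem_weightFiltration (hf : f ∈ weightFiltration K X Y Z w) :
    X * f ∈ weightFiltration K X Y Z (w + 1) := by
  refine mul_mem_weightFiltration_of_monomial K X (fun i j k ↦ ?_) hf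
  rw [← mul_assoc, ← pow_succ']
  exact monomial_mem_weightFiltration K (by lia)

lemma Z_mul_mem_weightFiltration (hX : Commute Z X) (hY : Commute Z Y)
    (hf : f ∈ weightFiltration K X Y Z w) : Z * f ∈ weightFiltration K X Y Z (w + 2) := by
  refine mul_mem_weightFiltration_of_monomial K Z (fun i j k ↦ ?_) hf
  rw [(hX.pow_right i).left_comm, (hY.pow_right j).left_comm, ← pow_succ']
  exact monomial_mem_weightFiltration K (by lia)

lemma Y_mul_mem_weightFiltration (hX : Commute Z X) (hY : Commute Z Y)
    (hYX : Y * X = X * Y + Z * ((1 + X) * (1 + Y)))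
    (hf : f ∈ weightFiltration K X Y Z w) : Y * f ∈ weightFiltration K X Y Z (w + 1) := by
  refine mul_mem_weightFiltration_of_monomial K Y (fun i j k ↦ ?_) hf
  induction i with
  | zero =>
    rw [pow_zero, one_mul, ← mul_assoc, ← pow_succ', ← one_mul (Y ^ (j + 1) * Z ^ k),
      ← pow_zero X]
    exact monomial_mem_weightFiltration K (by lia)
  | succ i ih =>
    set u := X ^ i * (Y ^ j * Z ^ k) with hu
    have hu_mem : u ∈ weightFiltration K X Y Z (i + j + 2 * k) :=
      monomial_mem_weightFiltration K le_rfl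
    have hYu : (1 + Y) * u ∈ weightFiltration K X Y Z (i + j + 2 * k) := by
      rw [add_mul, one_mul]
      exact add_mem hu_mem (weightFiltration_antitone K (by lia) ih)
    have hXYu : (1 + X) * ((1 + Y) * u) ∈ weightFiltration K X Y Z (i + j + 2 * k) := by
      rw [add_mul, one_mul]
      exact add_mem hYu
        (weightFiltration_antitone K (by lia) (X_mul_mem_weightFiltration K hYu))
    have key : Y * (X ^ (i + 1) * (Y ^ j * Z ^ k)) =
        X * (Y * u) + Z * ((1 + X) * ((1 + Y) * u)) := by
      rw [pow_succ', mul_assoc, ← hu, ← mul_assoc, hYX]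
      simp only [add_mul, mul_assoc]
    rw [key]
    exact add_mem (weightFiltration_antitone K (by lia) (X_mul_mem_weightFiltration K ih))
      (weightFiltration_antitone K (by lia) (Z_mul_mem_weightFiltration K hX hY hXYu))

lemma weightFiltration_eq_bot {m n l : ℕ} (hX : X ^ m = 0) (hY : Y ^ n = 0) (hZ : Z ^ l = 0)
    (hw : ∀ i < m, ∀ j < n, ∀ k < l, i + j + 2 * k < w) : weightFiltration K X Y Z w = ⊥ := by
  rw [weightFiltration, Submodule.span_eq_bot]
  rintro _ ⟨i, j, k, h, rfl⟩
  by_cases hi : i < m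
  · by_cases hj : j < n
    · by_cases hk : k < l
      · exact absurd h (hw i hi j hj k hk).not_ge
      · rw [pow_eq_zero_of_le (not_lt.1 hk) hZ, mul_zero, mul_zero]
    · rw [pow_eq_zero_of_le (not_lt.1 hj) hY, zero_mul, mul_zero]
  · rw [pow_eq_zero_of_le (not_lt.1 hi) hX, zero_mul]

end Filtration

section Augmentation

open MonoidAlgebra

variable (K G : Type*) [CommRing K] [Group G]

/-- The augmentation map of a group algebra. -/
noncomputable def augmentation : MonoidAlgebra K G →ₐ[K] K :=
  MonoidAlgebra.lift K K G 1

variable {K G}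

@[simp]
lemma augmentation_single (g : G) (r : K) : augmentation K G (single g r) = r := by
  simp [augmentation]

lemma one_sub_single_mem_ker_augmentation (g : G) :
    1 - single g 1 ∈ RingHom.ker (augmentation K G) := by
  simp [RingHom.mem_ker]

lemma augmentation_sub_mem (F : ℕ → Submodule K (MonoidAlgebra K G)) (w : ℕ)
    (h : ∀ g : G, ∀ f ∈ F w, (single g 1 - 1) * f ∈ F (w + 1)) (x : MonoidAlgebra K G)
    {f : MonoidAlgebra K G} (hf : f ∈ F w) : x * f - augmentation K G x • f ∈ F (w + 1) := by
  induction x using MonoidAlgebra.induction_linear with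
  | zero => simp
  | add x y hx hy =>
    rw [map_add, add_mul, add_smul, add_sub_add_comm]
    exact add_mem hx hy
  | single g r =>
    have : single g r * f - augmentation K G (single g r) • f =
        r • ((single g 1 - 1) * f) := by
      rw [augmentation_single, sub_mul, one_mul, smul_sub, ← smul_mul_assoc, smul_single,
        smul_eq_mul, mul_one]
    rw [this]
    exact Submodule.smul_mem _ _ (h g f hf)

/-- A decreasing filtration starting at `1` that is raised by the augmentation ideal contains the
powers of the augmentation ideal. -/
lemma ker_augmentation_pow_le (F : ℕ → Submodule K (MonoidAlgebra K G)) (hF : Antitone F)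
    (h1 : 1 ∈ F 0) (h : ∀ w, ∀ g : G, ∀ f ∈ F w, (single g 1 - 1) * f ∈ F (w + 1)) (n : ℕ)
    {x : MonoidAlgebra K G} (hx : x ∈ RingHom.ker (augmentation K G) ^ n) : x ∈ F n := by
  induction n generalizing x with
  | zero =>
    have := add_mem (hF zero_le_one (augmentation_sub_mem F 0 (h 0) x h1))
      (Submodule.smul_mem _ (augmentation K G x) h1)
    simpa using this
  | succ n ih =>
    rw [Ideal.IsTwoSided.pow_succ] at hx
    induction hx using Submodule.smul_induction_on' with
    | smul r hr s hs =>
      have := augmentation_sub_mem F n (h n) r (ih hs)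
      rwa [(RingHom.mem_ker).1 hr, zero_smul, sub_zero] at this
    | add x _ y _ hx hy => exact add_mem hx hy

/-- If left multiplication by `g - 1` raises a filtration for `g` in a generating set of a finite
group, it does so for all `g`. -/
lemma single_sub_one_mul_mem [Finite G] (F : ℕ → Submodule K (MonoidAlgebra K G))
    (hF : Antitone F) {s : Set G} (hs : Subgroup.closure s = ⊤)
    (h : ∀ w, ∀ g ∈ s, ∀ f ∈ F w, (single g 1 - 1) * f ∈ F (w + 1)) (w : ℕ) (g : G)
    {f : MonoidAlgebra K G} (hf : f ∈ F w) : (single g 1 - 1) * f ∈ F (w + 1) := by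
  have hg : g ∈ Submonoid.closure s := by
    rw [← Subgroup.closure_toSubmonoid_of_finite, hs]
    trivial
  induction hg using Submonoid.closure_induction generalizing f with
  | mem x hx => exact h w x hx f hf
  | one => simp [← one_def]
  | mul x y _ _ hx hy =>
    have hyf := hy hf
    have : (single (x * y) 1 - 1) * f =
        (single x 1 - 1) * ((single y 1 - 1) * f + f) + (single y 1 - 1) * f := by
      rw [← mul_one (1 : K), ← single_mul_single, mul_one]
      noncomm_ring
    rw [this]
    exact add_mem (hx (add_mem (hF (Nat.le_succ w) hyf) hf)) hyf

lemma jacobson_bot_eq_ker_augmentation [Nontrivial K] (hK : ∀ r : K, r = 0 ∨ IsUnit r) {n : ℕ}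
    (h : RingHom.ker (augmentation K G) ^ n = ⊥) :
    Ideal.jacobson (⊥ : Ideal (MonoidAlgebra K G)) = RingHom.ker (augmentation K G) := by
  apply le_antisymm
  · intro x hx
    rw [RingHom.mem_ker]
    refine (hK _).resolve_right fun hu ↦ ?_
    obtain ⟨r, hr⟩ := hu.exists_left_inv
    obtain ⟨z, hz⟩ := Ideal.mem_jacobson_iff.1 hx (single 1 (-r))
    rw [Ideal.mem_bot] at hz
    have := congrArg (augmentation K G) hz
    simp [mul_assoc, hr] at this
  · intro x hx
    rw [Ideal.mem_jacobson_iff]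
    intro y
    have hnil : IsNilpotent (y * x) := by
      refine ⟨n, ?_⟩
      rw [← Ideal.mem_bot, ← h]
      exact Ideal.pow_mem_pow (Ideal.mul_mem_left _ y hx) n
    obtain ⟨z, hz⟩ := hnil.isUnit_add_one.exists_left_inv
    refine ⟨z, ?_⟩
    rw [Ideal.mem_bot, mul_assoc, ← hz]
    noncomm_ring

end Augmentation

section OrderedProducts

open MonoidAlgebra

variable {G : Type*} [Group G] (K : Type*) [CommRing K]

lemma coeff_prod_one_sub_single_eq_zero (l : List G) (h : G)
    (hl : ∀ t : List G, t.Sublist l → t.prod ≠ h) :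
    ((l.map fun g ↦ (1 - single g 1 : MonoidAlgebra K G)).prod).coeff h = 0 := by
  induction l generalizing h with
  | nil =>
    have : (1 : G) ≠ h := hl [] List.Sublist.slnil
    simp [one_def, this]
  | cons g l ih =>
    have h1 := ih h fun t ht ↦ hl t (ht.cons g)
    have h2 := ih (g⁻¹ * h) fun t ht e ↦ hl (g :: t) (ht.cons_cons g) (by simp [e])
    rw [List.map_cons, List.prod_cons, sub_mul, one_mul]
    simp [h1, h2]

lemma coeff_prod_one_sub_single_one {l : List G} (hl : OrderedProductOneFree l) :
    ((l.map fun g ↦ (1 - single g 1 : MonoidAlgebra K G)).prod).coeff 1 = 1 := by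
  induction l with
  | nil => simp [one_def]
  | cons g l ih =>
    have h1 := ih fun t ht ↦ hl t (ht.cons g)
    have h2 := coeff_prod_one_sub_single_eq_zero K l (g⁻¹ * 1) fun t ht e ↦
      hl (g :: t) (ht.cons_cons g) (by simp) (by simp [e])
    rw [mul_one] at h2
    rw [List.map_cons, List.prod_cons, sub_mul, one_mul]
    simp [h1, h2]

lemma prod_one_sub_single_mem_pow (l : List G) :
    (l.map fun g ↦ (1 - single g 1 : MonoidAlgebra K G)).prod ∈
      RingHom.ker (augmentation K G) ^ l.length := by
  induction l with
  | nil => simp [Submodule.pow_zero]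
  | cons g l ih =>
    rw [List.map_cons, List.prod_cons, List.length_cons, Ideal.IsTwoSided.pow_succ]
    exact Ideal.mul_mem_mul (one_sub_single_mem_ker_augmentation g) ih

/-- Product-one free lists are shorter than the nilpotency index of the augmentation ideal. -/
lemma OrderedProductOneFree.length_lt [Nontrivial K] {l : List G} (hl : OrderedProductOneFree l)
    {n : ℕ} (hn : RingHom.ker (augmentation K G) ^ n = ⊥) : l.length < n := by
  by_contra! hle
  have hmem := Ideal.pow_le_pow_right hle (prod_one_sub_single_mem_pow K l)
  rw [hn, Ideal.mem_bot] at hmem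
  have h1 := coeff_prod_one_sub_single_one K hl
  rw [hmem] at h1
  simp at h1

/-- If the augmentation ideal over `𝔽_p` has nilpotency index at most `n + 1` and there is a
product-one free list of length `n`, both invariants equal `n + 1`. -/
lemma orderedDavenport_eq_and_loewyLength_eq (p : ℕ) [Fact p.Prime] {n : ℕ}
    (hn : RingHom.ker (augmentation (ZMod p) G) ^ (n + 1) = ⊥) {l : List G}
    (hl : OrderedProductOneFree l) (hlen : l.length = n) :
    orderedDavenport G = n + 1 ∧ loewyLength p G = n + 1 := by
  have hJ := jacobson_bot_eq_ker_augmentation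
    (fun r ↦ (eq_or_ne r 0).imp_right fun h ↦ h.isUnit) hn
  constructor
  · refine IsLeast.csInf_eq ⟨fun t ht hfree ↦ ?_, fun k hk ↦ ?_⟩
    · exact (hfree.length_lt (ZMod p) hn).not_ge ht
    · by_contra! hlt
      exact hk l (by lia) hl
  · refine IsLeast.csInf_eq ⟨⟨n.succ_pos, hJ ▸ hn⟩, fun k hk ↦ ?_⟩
    have := hl.length_lt (ZMod p) (hJ ▸ hk.2)
    lia

end OrderedProducts

section CentralCommutator

variable {G : Type*} [Group G] {a b c : G}

lemma dvd_of_pow_mul_pow_mul_pow_eq_one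
    (hint1 : Subgroup.zpowers a ⊓ Subgroup.zpowers c = ⊥)
    (hint2 : Subgroup.closure {a, c} ⊓ Subgroup.zpowers b = ⊥) {x y z : ℕ}
    (h : a ^ x * (b ^ y * c ^ z) = 1) :
    orderOf a ∣ x ∧ orderOf b ∣ y ∧ orderOf c ∣ z := by
  have ha : a ∈ Subgroup.closure {a, c} := Subgroup.subset_closure (by simp)
  have hc : c ∈ Subgroup.closure {a, c} := Subgroup.subset_closure (by simp)
  have hb : b ^ y = 1 := by
    rw [← Subgroup.mem_bot, ← hint2]
    refine Subgroup.mem_inf.2 ⟨?_, pow_mem (Subgroup.mem_zpowers b) y⟩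
    have : b ^ y = (a ^ x)⁻¹ * (c ^ z)⁻¹ := by
      rw [eq_mul_inv_iff_mul_eq]
      exact eq_inv_of_mul_eq_one_right h
    rw [this]
    exact mul_mem (inv_mem (pow_mem ha x)) (inv_mem (pow_mem hc z))
  rw [hb, one_mul] at h
  have hax : a ^ x = 1 := by
    rw [← Subgroup.mem_bot, ← hint1]
    refine Subgroup.mem_inf.2 ⟨pow_mem (Subgroup.mem_zpowers a) x, ?_⟩
    rw [eq_inv_of_mul_eq_one_left h]
    exact inv_mem (pow_mem (Subgroup.mem_zpowers c) z)
  rw [hax, one_mul] at h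
  exact ⟨orderOf_dvd_of_pow_eq_one hax, orderOf_dvd_of_pow_eq_one hb,
    orderOf_dvd_of_pow_eq_one h⟩

lemma prod_pow_eq_normalForm (hba : b * a = a * b * c) (hac : Commute c a) (hbc : Commute c b)
    {e₁ e₂ e₃ e₄ : ℕ} (i j : ℕ) (he₂ : e₂ ≤ 1) (he₃ : e₃ ≤ 1) :
    (a * c) ^ e₁ * (a ^ i * (b ^ e₂ * (a ^ e₃ * (b ^ j * (b * c) ^ e₄)))) =
      a ^ (e₁ + i + e₃) * (b ^ (e₂ + j + e₄) * c ^ (e₁ + e₂ * e₃ + e₄)) := by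
  have hswap : b ^ e₂ * a ^ e₃ = a ^ e₃ * (b ^ e₂ * c ^ (e₂ * e₃)) := by
    interval_cases e₂ <;> interval_cases e₃ <;> simp [hba, mul_assoc]
  have hca (k l : ℕ) (x : G) : c ^ k * (a ^ l * x) = a ^ l * (c ^ k * x) :=
    (hac.pow_pow k l).left_comm x
  have hcb (k l : ℕ) (x : G) : c ^ k * (b ^ l * x) = b ^ l * (c ^ k * x) :=
    (hbc.pow_pow k l).left_comm x
  rw [hac.symm.mul_pow, hbc.symm.mul_pow, ← mul_assoc (b ^ e₂), hswap]
  simp only [pow_add, mul_assoc, hca, hcb]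

/-- A list of length `m + n` which is product-one free when `m = orderOf a`, `n = orderOf b` and
`c` is the commutator of `a` and `b`, central of order two and independent of both. -/
def longProductOneFreeList (a b c : G) (m n : ℕ) : List G :=
  List.replicate 1 (a * c) ++ (List.replicate (m - 2) a ++ (List.replicate 1 b ++
    (List.replicate 1 a ++ (List.replicate (n - 2) b ++ List.replicate 1 (b * c)))))

lemma longProductOneFreeList_free (hba : b * a = a * b * c) (hac : Commute c a)
    (hbc : Commute c b) (hoc : orderOf c = 2)
    (hint1 : Subgroup.zpowers a ⊓ Subgroup.zpowers c = ⊥)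
    (hint2 : Subgroup.closure {a, c} ⊓ Subgroup.zpowers b = ⊥)
    (ha : 2 ≤ orderOf a) (hb : 2 ≤ orderOf b) :
    OrderedProductOneFree (longProductOneFreeList a b c (orderOf a) (orderOf b)) := by
  intro t ht hne hprod
  simp only [longProductOneFreeList, List.sublist_append_iff, List.sublist_replicate_iff] at ht
  obtain ⟨_, _, rfl, ⟨e₁, he₁, rfl⟩, _, _, rfl, ⟨i, hi, rfl⟩, _, _, rfl, ⟨e₂, he₂, rfl⟩,
    _, _, rfl, ⟨e₃, he₃, rfl⟩, _, _, rfl, ⟨j, hj, rfl⟩, ⟨e₄, he₄, rfl⟩⟩ := ht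
  simp only [List.prod_append, List.prod_replicate] at hprod
  rw [prod_pow_eq_normalForm hba hac hbc i j he₂ he₃] at hprod
  obtain ⟨hx, hy, hz⟩ := dvd_of_pow_mul_pow_mul_pow_eq_one hint1 hint2 hprod
  rw [hoc] at hz
  have hx' : e₁ + i + e₃ = 0 ∨ orderOf a ≤ e₁ + i + e₃ :=
    (Nat.eq_zero_or_pos _).imp_right fun h ↦ Nat.le_of_dvd h hx
  have hy' : e₂ + j + e₄ = 0 ∨ orderOf b ≤ e₂ + j + e₄ :=
    (Nat.eq_zero_or_pos _).imp_right fun h ↦ Nat.le_of_dvd h hy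
  have hpos : 0 < e₁ + i + e₂ + e₃ + j + e₄ := by
    have := List.length_pos_iff.2 hne
    simp only [List.length_append, List.length_replicate] at this
    lia
  interval_cases e₁ <;> interval_cases e₂ <;> interval_cases e₃ <;> interval_cases e₄ <;> lia

lemma length_longProductOneFreeList (a b c : G) {m n : ℕ} (hm : 2 ≤ m) (hn : 2 ≤ n) :
    (longProductOneFreeList a b c m n).length = m + n := by
  simp only [longProductOneFreeList, List.length_append, List.length_replicate]
  lia

open MonoidAlgebra in
lemma single_sub_one_pow_eq_zero (p k : ℕ) [Fact p.Prime] {g : G} (hg : g ^ p ^ k = 1) :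
    (single g 1 - 1 : MonoidAlgebra (ZMod p) G) ^ p ^ k = 0 := by
  have : CharP (MonoidAlgebra (ZMod p) G) p :=
    charP_of_injective_algebraMap (FaithfulSMul.algebraMap_injective (ZMod p) _) p
  rw [sub_pow_char_pow_of_commute _ _ (Commute.one_right _), single_pow, hg]
  simp [one_def]

open MonoidAlgebra in
lemma ker_augmentation_pow_eq_bot [Finite G] (p : ℕ) [Fact p.Prime]
    (hgen : Subgroup.closure {a, b, c} = ⊤) (hba : b * a = a * b * c)
    (hac : Commute c a) (hbc : Commute c b) {k l m w : ℕ}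
    (ha : a ^ p ^ k = 1) (hb : b ^ p ^ l = 1) (hc : c ^ p ^ m = 1)
    (hw : ∀ x < p ^ k, ∀ y < p ^ l, ∀ z < p ^ m, x + y + 2 * z < w) :
    RingHom.ker (augmentation (ZMod p) G) ^ w = ⊥ := by
  set X : MonoidAlgebra (ZMod p) G := single a 1 - 1 with hX
  set Y : MonoidAlgebra (ZMod p) G := single b 1 - 1 with hY
  set Z : MonoidAlgebra (ZMod p) G := single c 1 - 1 with hZ
  have hZX : Commute Z X := by
    have : Commute (single c 1 : MonoidAlgebra (ZMod p) G) (single a 1) := by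
      rw [Commute, SemiconjBy, single_mul_single, single_mul_single, hac.eq]
    exact (this.sub_left (Commute.one_left _)).sub_right (Commute.one_right _)
  have hZY : Commute Z Y := by
    have : Commute (single c 1 : MonoidAlgebra (ZMod p) G) (single b 1) := by
      rw [Commute, SemiconjBy, single_mul_single, single_mul_single, hbc.eq]
    exact (this.sub_left (Commute.one_left _)).sub_right (Commute.one_right _)
  have hYX : Y * X = X * Y + Z * ((1 + X) * (1 + Y)) := by
    have h1 : (single b 1 * single a 1 : MonoidAlgebra (ZMod p) G) =
        single c 1 * (single a 1 * single b 1) := by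
      simp only [single_mul_single, mul_one]
      rw [hba, ← (hac.mul_right hbc).eq]
    rw [hX, hY, hZ, add_sub_cancel, add_sub_cancel, sub_mul _ _ (_ * _), ← h1]
    noncomm_ring
  rw [eq_bot_iff]
  intro x hx
  have hbot := weightFiltration_eq_bot (ZMod p) (single_sub_one_pow_eq_zero p k ha)
    (single_sub_one_pow_eq_zero p l hb) (single_sub_one_pow_eq_zero p m hc) hw
  have hanti := weightFiltration_antitone (ZMod p) (X := X) (Y := Y) (Z := Z)
  have := ker_augmentation_pow_le (weightFiltration (ZMod p) X Y Z) hanti ?_ ?_ w hx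
  · rwa [hbot] at this
  · simpa using monomial_mem_weightFiltration (ZMod p) (X := X) (Y := Y) (Z := Z)
      (i := 0) (j := 0) (k := 0) le_rfl
  · intro v g f hf
    refine single_sub_one_mul_mem _ hanti hgen (fun v g hg f hf ↦ ?_) v g hf
    rcases hg with rfl | rfl | rfl
    · exact X_mul_mem_weightFiltration (ZMod p) hf
    · exact Y_mul_mem_weightFiltration (ZMod p) hZX hZY hYX hf
    · exact hanti (by lia) (Z_mul_mem_weightFiltration (ZMod p) hZX hZY hf)

end CentralCommutator

/-- For the group `G₁` with `γ = 1` (so `[a,b] = c` is central of order 2,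
`o(a) = 2^α`, `o(b) = 2^β`, `α ≥ β ≥ 1`), the ordered Davenport constant equals the Loewy
length: `D_o(G) = L(G) = 2^α + 2^β + 1`. -/
theorem orderedDavenport_eq_loewyLength_G1 (α β : ℕ) (hβα : β ≤ α) (hβ : 1 ≤ β)
    (G : Type*) [Group G] [Fintype G] (a b c : G)
    (hcard : Fintype.card G = 2 ^ (α + β + 1))
    (hgen : Subgroup.closure {a, b, c} = ⊤)
    (hab : a⁻¹ * b⁻¹ * a * b = c)
    (hac : a * c = c * a) (hbc : b * c = c * b)
    (hoa : orderOf a = 2 ^ α) (hob : orderOf b = 2 ^ β) (hoc : orderOf c = 2)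
    (hint1 : Subgroup.zpowers a ⊓ Subgroup.zpowers c = ⊥)
    (hint2 : Subgroup.closure {a, c} ⊓ Subgroup.zpowers b = ⊥) :
    orderedDavenport G = loewyLength 2 G ∧ loewyLength 2 G = 2 ^ α + 2 ^ β + 1 := by
  have hba : b * a = a * b * c := by
    have hcc : c * c = 1 := by rw [← sq, ← hoc, pow_orderOf_eq_one]
    have h : a * b = b * a * c := by rw [← hab]; group
    rw [h, mul_assoc, hcc, mul_one]
  have hca : Commute c a := hac.symm
  have hcb : Commute c b := hbc.symm
  have two_le {k : ℕ} (hk : 1 ≤ k) : 2 ≤ 2 ^ k := Nat.le_self_pow (by lia) 2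
  have ha2 : 2 ≤ 2 ^ α := two_le (hβ.trans hβα)
  have hb2 : 2 ≤ 2 ^ β := two_le hβ
  have hnil : RingHom.ker (augmentation (ZMod 2) G) ^ (2 ^ α + 2 ^ β + 1) = ⊥ :=
    ker_augmentation_pow_eq_bot 2 hgen hba hca hcb (m := 1) (hoa ▸ pow_orderOf_eq_one a)
      (hob ▸ pow_orderOf_eq_one b) (by rw [pow_one, ← hoc, pow_orderOf_eq_one])
      (fun x hx y hy z hz ↦ by lia)
  have hfree := longProductOneFreeList_free hba hca hcb hoc hint1 hint2
    (hoa ▸ ha2) (hob ▸ hb2)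
  rw [hoa, hob] at hfree
  obtain ⟨hD, hL⟩ := orderedDavenport_eq_and_loewyLength_eq 2 hnil hfree
    (length_longProductOneFreeList a b c ha2 hb2)
  exact ⟨hD.trans hL.symm, hL⟩
end

section
/- Let α, β, γ, σ be integers with β ≥ γ > σ ≥ 1 and α + σ ≥ 2γ, and let G be a finite group of order 2^(α+β+σ) together with elements a, b, c such that G is generated by {a, b, c}, a and c commute, the commutator [a,b] = a⁻¹b⁻¹ab equals a^(2^(α−γ)) · c, the commutator [c,b] equals a^(−2^(2(α−γ))) · c^(−2^(α−γ)), orderOf a = 2^α, orderOf b = 2^β, orderOf c = 2^σ, orderOf [a,b] = 2^γ, the cyclic subgroups ⟨a⟩ and ⟨c⟩ intersect trivially, and the subgroups ⟨a, c⟩ and ⟨b⟩ intersect trivially (this is the group G₃ = (⟨c⟩ × ⟨a⟩) ⋊ ⟨b⟩). Then the Loewy length of G satisfies L(G) = 2^α + 2^β + 2^(σ+1) − 3. -/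
section WeightSpan

variable {K R : Type*} [CommRing K] [Ring R] [Algebra K R]

/-- The span of the monomials `z ^ i * y ^ k * x ^ j` of weight at least `m`, where `x` and `y`
have weight one and `z` has weight two. -/
def weightSpan (K : Type*) {R : Type*} [CommRing K] [Ring R] [Algebra K R] (x y z : R) (m : ℕ) :
    Submodule K R :=
  Submodule.span K {r | ∃ i j k : ℕ, m ≤ 2 * i + k + j ∧ r = z ^ i * y ^ k * x ^ j}

variable {x y z : R} {m : ℕ}

theorem monomial_mem_weightSpan {i j k : ℕ} (h : m ≤ 2 * i + k + j) :
    z ^ i * y ^ k * x ^ j ∈ weightSpan K x y z m :=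
  Submodule.subset_span ⟨i, j, k, h, rfl⟩

theorem weightSpan_anti {n : ℕ} (h : m ≤ n) : weightSpan K x y z n ≤ weightSpan K x y z m :=
  Submodule.span_mono fun _ ⟨i, j, k, hw, hr⟩ => ⟨i, j, k, h.trans hw, hr⟩

theorem mul_mem_of_monomial_mul_mem {u e : R} {S : Submodule K R}
    (h : ∀ i j k : ℕ, m ≤ 2 * i + k + j → u * (z ^ i * y ^ k * x ^ j) ∈ S)
    (he : e ∈ weightSpan K x y z m) : u * e ∈ S := by
  have : weightSpan K x y z m ≤ S.comap (LinearMap.mulLeft K u) := by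
    refine Submodule.span_le.2 ?_
    rintro _ ⟨i, j, k, hw, rfl⟩
    exact h i j k hw
  exact this he

theorem y_mul_mem_weightSpan (hyz : Commute y z) {e : R} (he : e ∈ weightSpan K x y z m) :
    y * e ∈ weightSpan K x y z (m + 1) := by
  refine mul_mem_of_monomial_mul_mem (fun i j k hw => ?_) he
  rw [← mul_assoc, ← mul_assoc, (hyz.pow_right i).eq, mul_assoc (z ^ i), ← pow_succ']
  exact monomial_mem_weightSpan (by omega)

theorem x_mul_mem_weightSpan (hxz : Commute x z) (hyz : Commute y z)
    (hxy : x * y = y * x + (1 + y) * ((1 + x) * z)) {e : R} (he : e ∈ weightSpan K x y z m) :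
    x * e ∈ weightSpan K x y z (m + 1) := by
  refine mul_mem_of_monomial_mul_mem (fun i j k hw => ?_) he
  refine weightSpan_anti (Nat.add_le_add_right hw 1) ?_
  clear hw he
  induction k generalizing i with
  | zero =>
    rw [pow_zero, mul_one, ← mul_assoc, (hxz.pow_right i).eq, mul_assoc,
      ← pow_succ', ← mul_one (z ^ i), ← pow_zero y]
    exact monomial_mem_weightSpan (by omega)
  | succ k ih =>
    have key : x * (z ^ i * y ^ (k + 1) * x ^ j) =
        y * (x * (z ^ i * y ^ k * x ^ j)) +
          ((z ^ (i + 1) * y ^ k * x ^ j + x * (z ^ (i + 1) * y ^ k * x ^ j)) +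
            y * (z ^ (i + 1) * y ^ k * x ^ j + x * (z ^ (i + 1) * y ^ k * x ^ j))) := by
      have h : z ^ i * y ^ (k + 1) = y * (z ^ i * y ^ k) := by
        rw [pow_succ', ← mul_assoc, ← mul_assoc, (hyz.pow_right i).eq]
      rw [h, ← mul_assoc, ← mul_assoc x y, hxy, pow_succ']
      noncomm_ring
    have h1 := ih i
    have h2 : z ^ (i + 1) * y ^ k * x ^ j + x * (z ^ (i + 1) * y ^ k * x ^ j) ∈
        weightSpan K x y z (2 * i + k + j + 2) :=
      add_mem (monomial_mem_weightSpan (by omega))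
        (weightSpan_anti (by omega) (ih (i + 1)))
    rw [key]
    exact add_mem (weightSpan_anti (by omega) (y_mul_mem_weightSpan hyz h1))
      (add_mem (weightSpan_anti (by omega) h2)
        (weightSpan_anti (by omega) (y_mul_mem_weightSpan hyz h2)))

theorem weightSpan_eq_bot {A B S T : ℕ} (hyz : Commute y z) (hx : x ^ A = 0) (hy : y ^ B = 0)
    (hz : z ^ S = x ^ T) (hS : 0 < S) (hT : 2 * S ≤ T) (hm : A + B + 2 * S ≤ m + 3) :
    weightSpan K x y z m = ⊥ := by
  refine eq_bot_iff.2 (Submodule.span_le.2 ?_)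
  rintro _ ⟨i, j, k, hw, rfl⟩
  rw [SetLike.mem_coe, Submodule.mem_bot]
  induction i using Nat.strong_induction_on generalizing j with
  | _ i ih =>
    obtain hi | hi := lt_or_ge i S
    · obtain hj | hj := lt_or_ge j A
      · rw [pow_eq_zero_of_le (show B ≤ k by omega) hy, mul_zero, zero_mul]
      · rw [pow_eq_zero_of_le hj hx, mul_zero]
    · have h : z ^ i * y ^ k * x ^ j = z ^ (i - S) * y ^ k * x ^ (T + j) := by
        rw [pow_add x, ← hz, ← pow_sub_mul_pow z hi, mul_assoc _ (z ^ S),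
          ← (hyz.pow_pow k S).eq]
        simp only [mul_assoc]
      rw [h]
      exact ih (i - S) (by omega) (T + j) (by omega)

end WeightSpan

section Augmentation

open MonoidAlgebra

/-- The augmentation ideal of a group algebra: the kernel of `∑ r_g g ↦ ∑ r_g`. -/
noncomputable def augmentationIdeal (K G : Type*) [CommRing K] [Group G] :
    Ideal (MonoidAlgebra K G) :=
  RingHom.ker (lift K K G 1)

variable {K G : Type*} [Group G]

instance [CommRing K] : (augmentationIdeal K G).IsTwoSided :=
  inferInstanceAs (RingHom.ker (lift K K G 1)).IsTwoSided

theorem of_sub_one_mem_augmentationIdeal [CommRing K] (g : G) :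
    of K G g - 1 ∈ augmentationIdeal K G := by
  simp [augmentationIdeal, RingHom.mem_ker]

theorem jacobson_bot_eq_augmentationIdeal [Field K] {n : ℕ}
    (h : augmentationIdeal K G ^ n = ⊥) :
    Ideal.jacobson (⊥ : Ideal (MonoidAlgebra K G)) = augmentationIdeal K G := by
  refine le_antisymm (sInf_le ⟨bot_le, ?_⟩) fun x hx => Ideal.mem_jacobson_iff.2 fun y => ?_
  · refine RingHom.ker_isMaximal_of_surjective (lift K K G 1) fun r => ⟨algebraMap K _ r, ?_⟩
    rw [AlgHom.commutes, Algebra.algebraMap_self_apply]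
  · have hnil : IsNilpotent (y * x) := by
      refine ⟨n, ?_⟩
      have := Ideal.pow_mem_pow (Ideal.mul_mem_left _ y hx) n
      rwa [h, Ideal.mem_bot] at this
    obtain ⟨u, hu⟩ := hnil.isUnit_add_one
    refine ⟨↑u⁻¹, ?_⟩
    have : (↑u⁻¹ : MonoidAlgebra K G) * y * x + ↑u⁻¹ - 1 = 0 := by
      rw [mul_assoc, ← mul_add_one, ← hu, Units.inv_mul, sub_self]
    rw [this]
    exact zero_mem _

theorem augmentationIdeal_mul_mem [CommRing K] {S T : Submodule K (MonoidAlgebra K G)}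
    (h : ∀ g : G, ∀ e ∈ S, (of K G g - 1) * e ∈ T) {r e : MonoidAlgebra K G}
    (hr : r ∈ augmentationIdeal K G) (he : e ∈ S) : r * e ∈ T := by
  have key : (r - algebraMap K _ (lift K K G 1 r)) * e ∈ T := by
    clear hr
    induction r using MonoidAlgebra.induction_on with
    | of g =>
      have : lift K K G 1 (of K G g) = 1 := by simp
      rw [this, map_one]
      exact h g e he
    | add r s hr hs =>
      rw [map_add, map_add, add_sub_add_comm, add_mul]
      exact add_mem hr hs
    | smul c r hr =>
      have : c • r - algebraMap K (MonoidAlgebra K G) (lift K K G 1 (c • r)) =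
          c • (r - algebraMap K _ (lift K K G 1 r)) := by
        rw [map_smul, smul_eq_mul, map_mul, smul_sub, ← Algebra.smul_def]
      rw [this, smul_mul_assoc]
      exact T.smul_mem c hr
  rwa [show lift K K G 1 r = 0 from hr, map_zero, sub_zero] at key

theorem augmentationIdeal_pow_le [CommRing K] {S : ℕ → Submodule K (MonoidAlgebra K G)}
    (h : ∀ m, ∀ g : G, ∀ e ∈ S m, (of K G g - 1) * e ∈ S (m + 1)) (h1 : 1 ∈ S 0) (m : ℕ) :
    (augmentationIdeal K G ^ (m + 1)).restrictScalars K ≤ S (m + 1) := by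
  induction m with
  | zero =>
    intro r hr
    rw [zero_add, Submodule.restrictScalars_mem, Submodule.pow_one] at hr
    simpa using augmentationIdeal_mul_mem (h 0) hr h1
  | succ m ih =>
    intro r hr
    rw [Submodule.restrictScalars_mem, Ideal.IsTwoSided.pow_succ] at hr
    refine Submodule.smul_induction_on hr (fun r hr s hs => ?_) fun _ _ => add_mem
    exact augmentationIdeal_mul_mem (h (m + 1)) hr (ih hs)

theorem of_sub_one_mul_mem [CommRing K] [Finite G] {s : Set G}
    (hs : Subgroup.closure s = ⊤) {S : ℕ → Submodule K (MonoidAlgebra K G)} (hS : Antitone S)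
    (h : ∀ g ∈ s, ∀ m, ∀ e ∈ S m, (of K G g - 1) * e ∈ S (m + 1)) (m : ℕ) (g : G) :
    ∀ e ∈ S m, (of K G g - 1) * e ∈ S (m + 1) := by
  have hg : g ∈ Submonoid.closure s := by
    rw [← Subgroup.closure_toSubmonoid_of_finite, hs]
    trivial
  induction hg using Submonoid.closure_induction with
  | mem g hg => exact h g hg m
  | one => simp [← one_def]
  | mul g g' _ _ hg hg' =>
    intro e he
    have : (of K G (g * g') - 1) * e =
        (of K G g - 1) * ((of K G g' - 1) * e) + ((of K G g' - 1) * e + (of K G g - 1) * e) := by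
      rw [map_mul]
      noncomm_ring
    rw [this]
    exact add_mem (hg _ (hS m.le_succ (hg' e he))) (add_mem (hg' e he) (hg e he))

theorem sub_one_pow_eq_geom_sum {p : ℕ} [Fact p.Prime] {R : Type*} [Ring R] [Algebra (ZMod p) R]
    (t : R) (n : ℕ) : (t - 1) ^ (p ^ n - 1) = ∑ i ∈ Finset.range (p ^ n), t ^ i := by
  have key : (Polynomial.X - 1 : Polynomial (ZMod p)) ^ (p ^ n - 1) =
      ∑ i ∈ Finset.range (p ^ n), Polynomial.X ^ i := by
    have h0 : (Polynomial.X - 1 : Polynomial (ZMod p)) ≠ 0 := Polynomial.X_sub_C_ne_zero 1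
    refine mul_left_cancel₀ h0 ?_
    rw [mul_geom_sum, ← pow_succ', Nat.sub_add_cancel (Nat.pow_pos (Fact.out : p.Prime).pos),
      sub_pow_char_pow, one_pow]
  simpa using congrArg (Polynomial.aeval t) key

theorem of_geom_sum_mul_ne_zero [CommRing K] [Nontrivial K] {a b c : G} {l m n : ℕ}
    (hl : 0 < l) (hm : 0 < m) (hn : 0 < n)
    (h : ∀ i < l, ∀ j < m, ∀ k < n, a ^ i * c ^ j * b ^ k = 1 → i = 0 ∧ j = 0 ∧ k = 0) :
    (∑ i ∈ Finset.range l, of K G a ^ i) * (∑ j ∈ Finset.range m, of K G c ^ j) *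
      (∑ k ∈ Finset.range n, of K G b ^ k) ≠ 0 := by
  classical
  have hsum : (∑ i ∈ Finset.range l, of K G a ^ i) * (∑ j ∈ Finset.range m, of K G c ^ j) *
      (∑ k ∈ Finset.range n, of K G b ^ k) =
      ∑ q ∈ (Finset.range l ×ˢ Finset.range m) ×ˢ Finset.range n,
        single (a ^ q.1.1 * c ^ q.1.2 * b ^ q.2) (1 : K) := by
    rw [Finset.sum_mul_sum, ← Finset.sum_product', Finset.sum_mul_sum, ← Finset.sum_product']
    simp only [← map_pow, ← map_mul]
    rfl
  intro h0
  have h1 := congrArg (fun r : MonoidAlgebra K G => r.coeff 1) (hsum.symm.trans h0)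
  simp only [coeff_sum, Finsupp.finsetSum_apply] at h1
  rw [Finset.sum_eq_single ((0, 0), 0)] at h1
  · simp at h1
  · rintro ⟨⟨i, j⟩, k⟩ hq hne
    simp only [Finset.mem_product, Finset.mem_range] at hq
    rw [coeff_single, Finsupp.single_eq_of_ne]
    intro heq
    obtain ⟨rfl, rfl, rfl⟩ := h i hq.1.1 j hq.1.2 k hq.2 heq.symm
    exact hne rfl
  · intro hq
    simp [hl, hm, hn] at hq

end Augmentation

theorem commute_commutator_of_relations {G : Type*} [Group G] {a b c : G} {n : ℕ}
    (hac : Commute a c) (hab : a⁻¹ * b⁻¹ * a * b = a ^ n * c)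
    (hcb : c⁻¹ * b⁻¹ * c * b = ((a ^ n * c) ^ n)⁻¹) : Commute b (a ^ n * c) := by
  have ha : b⁻¹ * a * b = a * (a ^ n * c) := by
    rw [← hab]
    group
  have hc : b⁻¹ * c * b = c * ((a ^ n * c) ^ n)⁻¹ := by
    rw [← hcb]
    group
  have had : Commute a (a ^ n * c) := (Commute.self_pow a n).mul_right hac
  have hcd : Commute c (a ^ n * c) := (hac.symm.pow_right n).mul_right (Commute.refl c)
  have h : b⁻¹ * (a ^ n * c) * b = a ^ n * c := by
    calc b⁻¹ * (a ^ n * c) * b = (b⁻¹ * a * b) ^ n * (b⁻¹ * c * b) := by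
          have := conj_pow (i := n) (a := b⁻¹) (b := a)
          rw [inv_inv] at this
          rw [this]
          group
      _ = a ^ n * c := by
          rw [ha, hc, had.mul_pow, (hcd.pow_right n).inv_right.eq, mul_assoc,
            mul_inv_cancel_left]
  rw [Commute, SemiconjBy, ← eq_inv_mul_iff_mul_eq, ← mul_assoc, h]

theorem pow_mul_pow_mul_pow_eq_one {G : Type*} [Group G] {a b c : G}
    (hac : Subgroup.zpowers a ⊓ Subgroup.zpowers c = ⊥)
    (hb : Subgroup.closure {a, c} ⊓ Subgroup.zpowers b = ⊥) {i j k : ℕ} (hi : i < orderOf a)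
    (hj : j < orderOf c) (hk : k < orderOf b) (h : a ^ i * c ^ j * b ^ k = 1) :
    i = 0 ∧ j = 0 ∧ k = 0 := by
  have ha_mem : a ∈ Subgroup.closure {a, c} := Subgroup.subset_closure (by simp)
  have hc_mem : c ∈ Subgroup.closure {a, c} := Subgroup.subset_closure (by simp)
  have hbk : b ^ k = 1 := by
    rw [← Subgroup.mem_bot, ← hb]
    refine ⟨?_, pow_mem (Subgroup.mem_zpowers b) k⟩
    change _ ∈ Subgroup.closure {a, c}
    rw [eq_inv_of_mul_eq_one_right h]
    exact inv_mem (mul_mem (pow_mem ha_mem i) (pow_mem hc_mem j))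
  rw [hbk, mul_one] at h
  have hcj : c ^ j = 1 := by
    rw [← Subgroup.mem_bot, ← hac]
    refine ⟨?_, pow_mem (Subgroup.mem_zpowers c) j⟩
    change _ ∈ Subgroup.zpowers a
    rw [eq_inv_of_mul_eq_one_right h]
    exact inv_mem (pow_mem (Subgroup.mem_zpowers a) i)
  rw [hcj, mul_one] at h
  exact ⟨Nat.eq_zero_of_dvd_of_lt (orderOf_dvd_of_pow_eq_one h) hi,
    Nat.eq_zero_of_dvd_of_lt (orderOf_dvd_of_pow_eq_one hcj) hj,
    Nat.eq_zero_of_dvd_of_lt (orderOf_dvd_of_pow_eq_one hbk) hk⟩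

theorem charP_monoidAlgebra (p : ℕ) [Fact p.Prime] (G : Type*) [Group G] :
    CharP (MonoidAlgebra (ZMod p) G) p :=
  charP_of_injective_algebraMap' (ZMod p) p

open MonoidAlgebra in
theorem augmentationIdeal_pow_eq_bot {G : Type*} [Group G] [Finite G] {a b d : G} {α β σ τ m : ℕ}
    (hgen : Subgroup.closure {a, b} = ⊤) (had : Commute a d) (hbd : Commute b d)
    (hab : a * b = b * a * d) (ha : a ^ 2 ^ α = 1) (hb : b ^ 2 ^ β = 1)
    (hd : d ^ 2 ^ σ = a ^ 2 ^ τ) (hτ : σ + 1 ≤ τ)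
    (hm : 2 ^ α + 2 ^ β + 2 * 2 ^ σ ≤ (m + 1) + 3) :
    augmentationIdeal (ZMod 2) G ^ (m + 1) = ⊥ := by
  have := charP_monoidAlgebra 2 G
  have hpow (g : G) (n : ℕ) :
      (of (ZMod 2) G g - 1) ^ 2 ^ n = of (ZMod 2) G (g ^ 2 ^ n) - 1 := by
    rw [sub_pow_char_pow_of_commute 2 n (Commute.one_right _), one_pow, map_pow]
  have hcomm {g h : G} (hgh : Commute g h) :
      Commute (of (ZMod 2) G g - 1) (of (ZMod 2) G h - 1) :=
    ((hgh.map (of (ZMod 2) G)).sub_left (Commute.one_left _)).sub_right (Commute.one_right _)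
  set x := of (ZMod 2) G a - 1 with hx
  set y := of (ZMod 2) G b - 1 with hy
  set z := of (ZMod 2) G d - 1 with hz
  have hxy : x * y = y * x + (1 + y) * ((1 + x) * z) := by
    have h := congrArg (of (ZMod 2) G) hab
    rw [map_mul, map_mul, map_mul, ← sub_eq_zero] at h
    rw [← sub_eq_zero, ← h, hx, hy, hz]
    noncomm_ring
  have hbot : weightSpan (ZMod 2) x y z (m + 1) = ⊥ := by
    refine weightSpan_eq_bot (A := 2 ^ α) (B := 2 ^ β) (S := 2 ^ σ) (T := 2 ^ τ) (hcomm hbd)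
      ?_ ?_ ?_ (by positivity) ?_ hm
    · rw [hpow, ha, map_one, sub_self]
    · rw [hpow, hb, map_one, sub_self]
    · rw [hpow, hpow, hd]
    · rw [← pow_succ']
      exact Nat.pow_le_pow_right two_pos hτ
  have hone : (1 : MonoidAlgebra (ZMod 2) G) ∈ weightSpan (ZMod 2) x y z 0 :=
    Submodule.subset_span ⟨0, 0, 0, Nat.zero_le _, by simp⟩
  have hle := augmentationIdeal_pow_le (S := weightSpan (ZMod 2) x y z)
    (of_sub_one_mul_mem hgen (fun _ _ h => weightSpan_anti h) fun g hg n e he => by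
      obtain rfl | rfl := hg
      · exact x_mul_mem_weightSpan (hcomm had) (hcomm hbd) hxy he
      · exact y_mul_mem_weightSpan (hcomm hbd) he) hone m
  rwa [hbot, le_bot_iff, Submodule.restrictScalars_eq_bot_iff] at hle

open MonoidAlgebra in
theorem of_commutator_sub_one_mem_sq {K G : Type*} [CommRing K] [Group G] {a b d : G}
    (hab : a * b = b * a * d) : of K G d - 1 ∈ augmentationIdeal K G ^ 2 := by
  have hd : of K G d - 1 = of K G (b * a)⁻¹ *
      ((of K G a - 1) * (of K G b - 1) - (of K G b - 1) * (of K G a - 1)) := by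
    have h1 : of K G (b * a)⁻¹ * (of K G (a * b) - of K G (b * a)) = of K G d - 1 := by
      rw [mul_sub, ← map_mul, ← map_mul, hab, inv_mul_cancel, inv_mul_cancel_left, map_one]
    rw [← h1, map_mul _ a, map_mul _ b a]
    noncomm_ring
  rw [hd, Ideal.IsTwoSided.pow_succ, Submodule.pow_one]
  exact Ideal.mul_mem_left _ _
    (sub_mem (Ideal.mul_mem_mul (of_sub_one_mem_augmentationIdeal a)
      (of_sub_one_mem_augmentationIdeal b))
    (Ideal.mul_mem_mul (of_sub_one_mem_augmentationIdeal b)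
      (of_sub_one_mem_augmentationIdeal a)))

open MonoidAlgebra in
theorem augmentationIdeal_pow_ne_bot {G : Type*} [Group G] {a b c : G} {α β σ n m : ℕ}
    (hab : a * b = b * a * (a ^ 2 ^ n * c)) (hn : 1 ≤ n) (hoa : orderOf a = 2 ^ α)
    (hob : orderOf b = 2 ^ β) (hoc : orderOf c = 2 ^ σ)
    (hac : Subgroup.zpowers a ⊓ Subgroup.zpowers c = ⊥)
    (hb : Subgroup.closure {a, c} ⊓ Subgroup.zpowers b = ⊥)
    (hm : m ≤ (2 ^ α - 1) + 2 * (2 ^ σ - 1) + (2 ^ β - 1)) :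
    augmentationIdeal (ZMod 2) G ^ m ≠ ⊥ := by
  have := charP_monoidAlgebra 2 G
  have hc : of (ZMod 2) G c - 1 ∈ augmentationIdeal (ZMod 2) G ^ 2 := by
    have h1 : of (ZMod 2) G (a ^ 2 ^ n) - 1 ∈ augmentationIdeal (ZMod 2) G ^ 2 := by
      rw [map_pow, ← one_pow (2 ^ n), ← sub_pow_char_pow_of_commute 2 n (Commute.one_right _)]
      exact Ideal.pow_le_pow_right (Nat.le_self_pow (by omega) 2)
        (Ideal.pow_mem_pow (of_sub_one_mem_augmentationIdeal a) _)
    have h2 : of (ZMod 2) G c - 1 = of (ZMod 2) G (a ^ 2 ^ n)⁻¹ *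
        ((of (ZMod 2) G (a ^ 2 ^ n * c) - 1) - (of (ZMod 2) G (a ^ 2 ^ n) - 1)) := by
      rw [sub_sub_sub_cancel_right, mul_sub, ← map_mul, ← map_mul, inv_mul_cancel,
        inv_mul_cancel_left, map_one]
    rw [h2]
    exact Ideal.mul_mem_left _ _ (sub_mem (of_commutator_sub_one_mem_sq hab) h1)
  have hcpow (k : ℕ) : (of (ZMod 2) G c - 1) ^ k ∈ augmentationIdeal (ZMod 2) G ^ (2 * k) := by
    induction k with
    | zero => simp [Submodule.pow_zero]
    | succ k ih =>
      rw [pow_succ, mul_add_one, Ideal.IsTwoSided.pow_add]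
      exact Ideal.mul_mem_mul ih hc
  intro hbot
  have hprod : (of (ZMod 2) G a - 1) ^ (2 ^ α - 1) * (of (ZMod 2) G c - 1) ^ (2 ^ σ - 1) *
      (of (ZMod 2) G b - 1) ^ (2 ^ β - 1) ∈
      augmentationIdeal (ZMod 2) G ^ ((2 ^ α - 1) + 2 * (2 ^ σ - 1) + (2 ^ β - 1)) := by
    rw [Ideal.IsTwoSided.pow_add, Ideal.IsTwoSided.pow_add]
    exact Ideal.mul_mem_mul
      (Ideal.mul_mem_mul (Ideal.pow_mem_pow (of_sub_one_mem_augmentationIdeal a) _) (hcpow _))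
      (Ideal.pow_mem_pow (of_sub_one_mem_augmentationIdeal b) _)
  have hmem := Ideal.pow_le_pow_right hm hprod
  rw [hbot, Ideal.mem_bot, sub_one_pow_eq_geom_sum, sub_one_pow_eq_geom_sum,
    sub_one_pow_eq_geom_sum] at hmem
  refine of_geom_sum_mul_ne_zero (by positivity) (by positivity) (by positivity)
    (fun i hi j hj k hk => ?_) hmem
  exact pow_mul_pow_mul_pow_eq_one hac hb (hoa ▸ hi) (hoc ▸ hj) (hob ▸ hk)

theorem loewyLength_eq_of_augmentationIdeal_pow {p m : ℕ} [Fact p.Prime] {G : Type*} [Group G]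
    (h : augmentationIdeal (ZMod p) G ^ (m + 1) = ⊥) (h' : augmentationIdeal (ZMod p) G ^ m ≠ ⊥) :
    loewyLength p G = m + 1 := by
  rw [loewyLength, jacobson_bot_eq_augmentationIdeal h]
  refine le_antisymm (Nat.sInf_le ⟨m.succ_pos, h⟩) (le_csInf ⟨m + 1, m.succ_pos, h⟩ ?_)
  rintro k ⟨_, hk⟩
  by_contra! hlt
  exact h' (eq_bot_iff.2 ((Ideal.pow_le_pow_right (Nat.le_of_lt_succ hlt)).trans hk.le))

/-- For the group `G₃ = (⟨c⟩ × ⟨a⟩) ⋊ ⟨b⟩` with `[a,b] = a^(2^(α−γ)) c`,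
`[c,b] = a^(−2^(2(α−γ))) c^(−2^(α−γ))`, `o(a) = 2^α`, `o(b) = 2^β`, `o(c) = 2^σ`,
`o([a,b]) = 2^γ`, where `β ≥ γ > σ ≥ 1` and `α + σ ≥ 2γ`, the Loewy length satisfies
`L(G) = 2^α + 2^β + 2^(σ+1) - 3`. -/
theorem loewyLength_G3 (α β γ σ : ℕ) (h1 : γ ≤ β) (h2 : σ < γ) (h3 : 1 ≤ σ)
    (h4 : 2 * γ ≤ α + σ)
    (G : Type*) [Group G] [Fintype G] (a b c : G)
    (hcard : Fintype.card G = 2 ^ (α + β + σ))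
    (hgen : Subgroup.closure {a, b, c} = ⊤)
    (hac : a * c = c * a)
    (hab : a⁻¹ * b⁻¹ * a * b = a ^ (2 ^ (α - γ)) * c)
    (hcb : c⁻¹ * b⁻¹ * c * b = a ^ (-(2 ^ (2 * (α - γ)) : ℤ)) * c ^ (-(2 ^ (α - γ) : ℤ)))
    (hoa : orderOf a = 2 ^ α) (hob : orderOf b = 2 ^ β) (hoc : orderOf c = 2 ^ σ)
    (hoab : orderOf (a⁻¹ * b⁻¹ * a * b) = 2 ^ γ)
    (hint1 : Subgroup.zpowers a ⊓ Subgroup.zpowers c = ⊥)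
    (hint2 : Subgroup.closure {a, c} ⊓ Subgroup.zpowers b = ⊥) :
    loewyLength 2 G = 2 ^ α + 2 ^ β + 2 ^ (σ + 1) - 3 := by
  obtain ⟨n, rfl⟩ : ∃ n, α = γ + n := ⟨α - γ, by omega⟩
  rw [Nat.add_sub_cancel_left] at hab hcb
  set d := a ^ 2 ^ n * c with hd
  have hac' : Commute a c := hac
  have hdn : d ^ 2 ^ n = a ^ 2 ^ (2 * n) * c ^ 2 ^ n := by
    rw [hd, (hac'.pow_left _).mul_pow, ← pow_mul, ← pow_add, two_mul]
  have hcb' : c⁻¹ * b⁻¹ * c * b = (d ^ 2 ^ n)⁻¹ := by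
    rw [hcb, hdn, (hac'.pow_pow _ _).eq, mul_inv_rev, zpow_neg, zpow_neg]
    norm_cast
  have hbd : Commute b d := commute_commutator_of_relations hac' hab hcb'
  have had : Commute a d := (Commute.self_pow a _).mul_right hac'
  have hab' : a * b = b * a * d := by
    rw [← hab]
    group
  have hdσ : d ^ 2 ^ σ = a ^ 2 ^ (n + σ) := by
    rw [hd, (hac'.pow_left _).mul_pow, ← hoc, pow_orderOf_eq_one, mul_one, hoc,
      ← pow_mul, ← pow_add]
  have hgen' : Subgroup.closure {a, b} = ⊤ := by
    have ha_mem : a ∈ Subgroup.closure {a, b} := Subgroup.subset_closure (by simp)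
    have hb_mem : b ∈ Subgroup.closure {a, b} := Subgroup.subset_closure (by simp)
    have hd_mem : d ∈ Subgroup.closure {a, b} := hab ▸
      mul_mem (mul_mem (mul_mem (inv_mem ha_mem) (inv_mem hb_mem)) ha_mem) hb_mem
    rw [eq_top_iff, ← hgen, Subgroup.closure_le]
    rintro g (rfl | rfl | rfl)
    · exact ha_mem
    · exact hb_mem
    · exact (Subgroup.mul_mem_cancel_left _ (pow_mem ha_mem _)).1 hd_mem
  have hα : 2 ≤ 2 ^ (γ + n) := Nat.le_self_pow (by omega) 2
  have hβ : 2 ≤ 2 ^ β := Nat.le_self_pow (by omega) 2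
  have hσ : 0 < 2 ^ σ := by positivity
  rw [pow_succ' 2 σ, loewyLength_eq_of_augmentationIdeal_pow
    (m := 2 ^ (γ + n) + 2 ^ β + 2 * 2 ^ σ - 4)]
  · omega
  · exact augmentationIdeal_pow_eq_bot hgen' had hbd hab' (hoa ▸ pow_orderOf_eq_one a)
      (hob ▸ pow_orderOf_eq_one b) hdσ (by omega) (by omega)
  · exact augmentationIdeal_pow_ne_bot hab' (by omega) hoa hob hoc hint1 hint2 (by omega)
end
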